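/- arXiv:2107.10832 — 4 statements merged into one kernel-verified Lean document; each statement's English description precedes it below -/
import Mathlib

section
/- The distribution axiom for E is not in general valid: there exist distinct propositional variables p, q, an expertise model M, and a state x of M such that M,x ⊨ E(p → q) ∧ Ep ∧ ¬Eq. (For instance X = {a,b,c}, P = {∅, {a}, {b,c}, X}, v(p) = {a}, v(q) = {b} gives such a model.) -/
/-- The language 𝓛: propositional variables (indexed by ℕ, hence countable),
negation, conjunction, and modalities E (expertise), S (soundness), A (universal). -/
inductive Form : Type where
  | var : ℕ → Form
  | neg : Form → Form
  | and : Form → Form → Form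
  | E : Form → Form
  | S : Form → Form
  | A : Form → Form

/-- Material implication, as the usual Boolean abbreviation. -/
def Form.imp (φ ψ : Form) : Form := .neg (.and φ (.neg ψ))

/-- Biconditional, as the usual Boolean abbreviation. -/
def Form.iff (φ ψ : Form) : Form := .and (φ.imp ψ) (ψ.imp φ)

/-- An expertise model on a set of states `X`: an expertise set `P`
(containing `X`, closed under complements and arbitrary intersections)
together with a valuation `v`. -/
structure ExpModel (X : Type*) where
  P : Set (Set X)
  univ_mem : Set.univ ∈ P
  compl_mem : ∀ A ∈ P, Aᶜ ∈ P
  sInter_mem : ∀ Q ⊆ P, ⋂₀ Q ∈ P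
  v : ℕ → Set X

/-- The truth set `‖φ‖_M` of a formula in an expertise model. -/
def truthSet {X : Type*} (M : ExpModel X) : Form → Set X
  | .var p => M.v p
  | .neg φ => (truthSet M φ)ᶜ
  | .and φ ψ => truthSet M φ ∩ truthSet M ψ
  | .E φ => {_x | truthSet M φ ∈ M.P}
  | .S φ => {x | ∀ A ∈ M.P, truthSet M φ ⊆ A → x ∈ A}
  | .A φ => {_x | ∀ y, y ∈ truthSet M φ}

/-- Satisfaction: `M, x ⊨ φ`. -/
def Sat {X : Type*} (M : ExpModel X) (x : X) (φ : Form) : Prop :=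
  x ∈ truthSet M φ

/-- Validity: `φ` is true at every state of every expertise model. -/
def Valid (φ : Form) : Prop :=
  ∀ (X : Type*) (M : ExpModel X) (x : X), Sat M x φ

/-- The expertise model whose expertise set consists of the sets that do not separate
the states `a` and `b`. -/
def ExpModel.nonseparating {X : Type*} (a b : X) (v : ℕ → Set X) : ExpModel X where
  P := {s | a ∈ s ↔ b ∈ s}
  univ_mem := by simp
  compl_mem _ hs := not_congr hs
  sInter_mem _ hQ := forall₂_congr fun _ hs => hQ hs
  v := v

/-- The distribution axiom for E is not in general valid: there are distinct
propositional variables p, q, an expertise model M and a state x with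
M, x ⊨ E(p → q) ∧ Ep ∧ ¬Eq. -/
theorem E_distribution_invalid :
    ∃ (p q : ℕ), p ≠ q ∧ ∃ (X : Type) (M : ExpModel X) (x : X),
      Sat M x (.and (.E ((Form.var p).imp (.var q)))
        (.and (.E (.var p)) (.neg (.E (.var q))))) := by
  refine ⟨0, 1, zero_ne_one, Fin 3,
    .nonseparating 1 2 (fun n => if n = 0 then {0} else {1}), 0, ?_⟩
  simp [Sat, truthSet, Form.imp, ExpModel.nonseparating]
end

section
/- Let M = (X, P, v) be an expertise model and define the translation t from 𝓛 to the language 𝓛_{KA} by: t(p) = p, t commutes with ¬, ∧ and A, t(Eφ) = A(t(φ) → K t(φ)), and t(Sφ) = ¬K¬t(φ). Let R_P be the equivalence relation on X induced by P (x R_P y iff the smallest element of P containing x equals the smallest element of P containing y), and let M* = (X, R_P, v) be the corresponding relational (S5) model. Then for every formula φ of 𝓛 and every x ∈ X: M,x ⊨ φ if and only if M*,x ⊨ t(φ). -/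
/-- The language 𝓛_{KA}: propositional variables, ¬, ∧, and modalities K and A. -/
inductive KForm : Type where
  | var : ℕ → KForm
  | neg : KForm → KForm
  | and : KForm → KForm → KForm
  | K : KForm → KForm
  | A : KForm → KForm

/-- Material implication in 𝓛_{KA}. -/
def KForm.imp (φ ψ : KForm) : KForm := .neg (.and φ (.neg ψ))

/-- Truth set of a 𝓛_{KA} formula in a relational model (X, R, v):
K is interpreted via the accessibility relation R, and A is the universal modality. -/
def kTruthSet {X : Type*} (R : X → X → Prop) (v : ℕ → Set X) : KForm → Set X
  | .var p => v p
  | .neg φ => (kTruthSet R v φ)ᶜ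
  | .and φ ψ => kTruthSet R v φ ∩ kTruthSet R v ψ
  | .K φ => {x | ∀ y, R x y → y ∈ kTruthSet R v φ}
  | .A φ => {_x | ∀ y, y ∈ kTruthSet R v φ}

/-- The translation t : 𝓛 → 𝓛_{KA}: t commutes with atoms, ¬, ∧ and A, and
t(Eφ) = A(t(φ) → K t(φ)),  t(Sφ) = ¬K¬t(φ). -/
def tr : Form → KForm
  | .var p => .var p
  | .neg φ => .neg (tr φ)
  | .and φ ψ => .and (tr φ) (tr ψ)
  | .E φ => .A ((tr φ).imp (.K (tr φ)))
  | .S φ => .neg (.K (.neg (tr φ)))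
  | .A φ => .A (tr φ)

/-- The cell of x: the smallest element of P containing x. -/
def cell {X : Type*} (P : Set (Set X)) (x : X) : Set X := ⋂₀ {A ∈ P | x ∈ A}

/-- The relation R_P induced by an expertise set: x R_P y iff A_x = A_y. -/
def relOf {X : Type*} (P : Set (Set X)) (x y : X) : Prop := cell P x = cell P y

namespace ExpModel

variable {X : Type*} (M : ExpModel X)

theorem self_mem_cell (P : Set (Set X)) (x : X) : x ∈ cell P x := fun _ hA => hA.2

theorem cell_subset {P : Set (Set X)} {A : Set X} {x : X} (hA : A ∈ P) (hx : x ∈ A) :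
    cell P x ⊆ A := Set.sInter_subset_of_mem ⟨hA, hx⟩

theorem cell_mem (x : X) : cell M.P x ∈ M.P := M.sInter_mem _ fun _ hA => hA.1

theorem mem_cell_iff {x y : X} : y ∈ cell M.P x ↔ relOf M.P x y := by
  refine ⟨fun hy => ?_, fun h => ?_⟩
  · have hx : x ∈ cell M.P y := by
      by_contra hx
      exact cell_subset (M.compl_mem _ (M.cell_mem y)) hx hy (self_mem_cell _ y)
    exact (cell_subset (M.cell_mem y) hx).antisymm (cell_subset (M.cell_mem x) hy)
  · have h : cell M.P x = cell M.P y := h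
    exact h ▸ self_mem_cell M.P y

/-- The expertise set consists of exactly the sets closed under its induced relation. -/
theorem mem_P_iff {A : Set X} : A ∈ M.P ↔ ∀ x ∈ A, ∀ y, relOf M.P x y → y ∈ A := by
  refine ⟨fun hA x hx y h => cell_subset hA hx (M.mem_cell_iff.2 h), fun h => ?_⟩
  have hA : A = ⋂₀ ((fun x => (cell M.P x)ᶜ) '' Aᶜ) := by
    ext y
    simp only [Set.sInter_image, Set.mem_iInter, Set.mem_compl_iff, mem_cell_iff]
    exact ⟨fun hy x hx hxy => hx (h y hy x hxy.symm), fun hy => by_contra fun hyA => hy y hyA rfl⟩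
  rw [hA]
  refine M.sInter_mem _ ?_
  rintro _ ⟨x, -, rfl⟩
  exact M.compl_mem _ (M.cell_mem x)

theorem forall_superset_mem_iff {B : Set X} {x : X} :
    (∀ A ∈ M.P, B ⊆ A → x ∈ A) ↔ ∃ y, relOf M.P x y ∧ y ∈ B := by
  refine ⟨fun h => ?_, ?_⟩
  · by_contra! hB
    exact h _ (M.compl_mem _ (M.cell_mem x)) (fun y hy hyx => hB y (M.mem_cell_iff.1 hyx) hy)
      (self_mem_cell _ x)
  · rintro ⟨y, hxy, hy⟩ A hA hBA
    exact M.mem_P_iff.1 hA y (hBA hy) x hxy.symm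

theorem truthSet_eq_kTruthSet_tr (φ : Form) :
    truthSet M φ = kTruthSet (relOf M.P) M.v (tr φ) := by
  induction φ with
  | var p => rfl
  | neg φ ih => simp only [truthSet, tr, kTruthSet, ih]
  | and φ ψ ihφ ihψ => simp only [truthSet, tr, kTruthSet, ihφ, ihψ]
  | E φ ih =>
    ext x
    simp [truthSet, tr, kTruthSet, KForm.imp, ← ih, mem_P_iff]
  | S φ ih =>
    ext x
    simp [truthSet, tr, kTruthSet, ← ih, forall_superset_mem_iff]
  | A φ ih => simp only [truthSet, tr, kTruthSet, ih]

end ExpModel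

/-- For an expertise model M = (X, P, v), the relational model M* = (X, R_P, v)
is an S5 model (R_P is an equivalence relation), and for every formula φ of 𝓛 and
state x:  M, x ⊨ φ  iff  M*, x ⊨ t(φ). -/
theorem expertise_to_S5 {X : Type*} (M : ExpModel X) :
    Equivalence (relOf M.P) ∧
    ∀ (φ : Form) (x : X), Sat M x φ ↔ x ∈ kTruthSet (relOf M.P) M.v (tr φ) := by
  exact ⟨⟨fun _ => rfl, Eq.symm, Eq.trans⟩,
    fun φ x => Set.ext_iff.1 (M.truthSet_eq_kTruthSet_tr φ) x⟩
end

section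
/- For every formula φ of the language 𝓛, the formula Eφ ↔ A(Sφ → φ) is valid: it is true at every state of every expertise model. -/
section

variable {X : Type*} {M : ExpModel X} {x : X} {φ ψ : Form}

theorem sat_imp : Sat M x (φ.imp ψ) ↔ (Sat M x φ → Sat M x ψ) := by
  simp [Sat, Form.imp, truthSet]

theorem sat_iff : Sat M x (φ.iff ψ) ↔ (Sat M x φ ↔ Sat M x ψ) :=
  (and_congr sat_imp sat_imp).trans iff_def.symm

theorem sat_A : Sat M x (.A φ) ↔ ∀ y, Sat M y φ := Iff.rfl

/-- The truth set of `Sφ` is the least member of `P` containing the truth set of `φ`. -/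
theorem truthSet_S (M : ExpModel X) (φ : Form) :
    truthSet M (.S φ) = ⋂₀ {A | A ∈ M.P ∧ truthSet M φ ⊆ A} := by
  ext x
  simp [truthSet]

theorem truthSet_S_mem (M : ExpModel X) (φ : Form) : truthSet M (.S φ) ∈ M.P := by
  rw [truthSet_S]
  exact M.sInter_mem _ fun _ hA => hA.1

theorem truthSet_subset_truthSet_S (M : ExpModel X) (φ : Form) :
    truthSet M φ ⊆ truthSet M (.S φ) :=
  fun _ hx _ _ hA => hA hx

theorem truthSet_mem_iff (M : ExpModel X) (φ : Form) :
    truthSet M φ ∈ M.P ↔ truthSet M (.S φ) ⊆ truthSet M φ :=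
  ⟨fun h _ hx => hx _ h subset_rfl, fun h =>
    h.antisymm (truthSet_subset_truthSet_S M φ) ▸ truthSet_S_mem M φ⟩

end

/-- The formula Eφ ↔ A(Sφ → φ) is valid. -/
theorem valid_E_iff_A_S_imp (φ : Form) :
    Valid ((Form.E φ).iff (.A ((Form.S φ).imp φ))) := by
  intro X M x
  simp only [sat_iff, sat_A, sat_imp]
  exact truthSet_mem_iff M φ
end

section
/- The axiom K_S is valid in all expertise frames: for all formulas φ, ψ of 𝓛, every expertise model M, and every state x, if M,x ⊨ Sφ ∧ ¬Sψ then M,x ⊨ S(φ ∧ ¬ψ). -/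
theorem ExpModel.union_mem {X : Type*} (M : ExpModel X) {A B : Set X}
    (hA : A ∈ M.P) (hB : B ∈ M.P) : A ∪ B ∈ M.P := by
  have h : ⋂₀ {Aᶜ, Bᶜ} ∈ M.P := by
    refine M.sInter_mem _ ?_
    rintro C (rfl | rfl)
    exacts [M.compl_mem A hA, M.compl_mem B hB]
  simpa [Set.sInter_pair, Set.compl_inter] using M.compl_mem _ h

/-- Axiom K_S is valid in all expertise frames: if M, x ⊨ Sφ ∧ ¬Sψ then
M, x ⊨ S(φ ∧ ¬ψ). -/
theorem valid_KS (φ ψ : Form) {X : Type*} (M : ExpModel X) (x : X)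
    (h : Sat M x (.and (.S φ) (.neg (.S ψ)))) :
    Sat M x (.S (.and φ (.neg ψ))) := by
  obtain ⟨hφ, hψ⟩ := h
  have hψ' : ¬ ∀ B ∈ M.P, truthSet M ψ ⊆ B → x ∈ B := hψ
  push Not at hψ'
  obtain ⟨B, hB, hψB, hxB⟩ := hψ'
  intro A hA hsub
  refine (hφ (A ∪ B) (M.union_mem hA hB) fun y hy => ?_).resolve_right hxB
  by_cases hyψ : y ∈ truthSet M ψ
  · exact Or.inr (hψB hyψ)
  · exact Or.inl (hsub ⟨hy, hyψ⟩)
end
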